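/- For all δ>0 there exists Δ₀=Δ₀(δ) such that for every finite graph G=(V,E) with maximum degree Δ≥Δ₀ and every 0<λ<(1−δ)·λ_c(Δ), there exists a function Φ : V → ℝ≥0 such that for every v∈V: 1 ≤ Φ(v) ≤ 12, and (1−δ/6)·Φ(v) ≥ Σ_{u∈N(v)} (λ·ω*(u)/(1+λ·ω*(u)))·Φ(u), where ω* is the unique fixed point of the belief-propagation operator F. -/

import Mathlib

open scoped BigOperators

noncomputable section

namespace HardCore

/-- The critical fugacity `λ_c(Δ) = (Δ-1)^(Δ-1) / (Δ-2)^Δ`. -/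
def lambdaC (D : ℕ) : ℝ := ((D : ℝ) - 1) ^ (D - 1) / ((D : ℝ) - 2) ^ D

variable {V : Type} [Fintype V] [DecidableEq V]

/-- The belief-propagation operator `F(ω)(v) = ∏_{u ∈ N(v)} 1/(1 + λ·ω(u))`. -/
def bpF (G : SimpleGraph V) [DecidableRel G.Adj] (lam : ℝ) (ω : V → ℝ) : V → ℝ :=
  fun v => ∏ u ∈ G.neighborFinset v, (1 + lam * ω u)⁻¹

end HardCore

open HardCore

namespace HardCore

/-- For large `Δ`, `Δ · λ_c(Δ)` is nonnegative and at most `e (1 + ε)`. -/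
lemma exists_forall_mul_lambdaC_le {ε : ℝ} (hε : 0 < ε) :
    ∃ D₀ : ℕ, ∀ D : ℕ, D₀ ≤ D →
      0 ≤ lambdaC D ∧ (D : ℝ) * lambdaC D ≤ Real.exp 1 * (1 + ε) := by
  have hinv : Filter.Tendsto (fun n : ℕ => ((n : ℝ))⁻¹) Filter.atTop (nhds 0) :=
    tendsto_inv_atTop_nhds_zero_nat
  have hlim : Filter.Tendsto (fun n : ℕ => (1 + 2 * (n : ℝ)⁻¹) * Real.exp (1 + (n : ℝ)⁻¹))
      Filter.atTop (nhds ((1 + 2 * 0) * Real.exp (1 + 0))) :=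
    ((hinv.const_mul 2).const_add 1).mul
      ((Real.continuous_exp.tendsto _).comp (hinv.const_add 1))
  have hlt : (1 + 2 * 0) * Real.exp (1 + 0) < Real.exp 1 * (1 + ε) := by
    have := Real.exp_pos 1
    simp only [mul_zero, add_zero, one_mul]
    nlinarith
  obtain ⟨N, hN⟩ := Filter.eventually_atTop.1 (hlim.eventually (gt_mem_nhds hlt))
  refine ⟨N + 3, fun D hD => ?_⟩
  obtain ⟨n, rfl⟩ : ∃ n, D = n + 2 := ⟨D - 2, by omega⟩
  have hn : (0 : ℝ) < n := by exact_mod_cast (by omega : 0 < n)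
  have hform : lambdaC (n + 2) = (1 + (n : ℝ)⁻¹) ^ (n + 1) * (n : ℝ)⁻¹ := by
    have h1 : ((n + 2 : ℕ) : ℝ) - 1 = n + 1 := by push_cast; ring
    have h2 : ((n + 2 : ℕ) : ℝ) - 2 = n := by push_cast; ring
    have h3 : 1 + (n : ℝ)⁻¹ = (n + 1) / n := by field_simp
    rw [lambdaC, h1, h2, h3, div_pow, show n + 2 - 1 = n + 1 by omega, pow_succ (n : ℝ) (n + 1)]
    field_simp
  have hpow : (1 + (n : ℝ)⁻¹) ^ (n + 1) ≤ Real.exp (1 + (n : ℝ)⁻¹) := by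
    calc (1 + (n : ℝ)⁻¹) ^ (n + 1) ≤ Real.exp ((n : ℝ)⁻¹) ^ (n + 1) := by
          gcongr
          linarith [Real.add_one_le_exp ((n : ℝ)⁻¹)]
      _ = Real.exp (1 + (n : ℝ)⁻¹) := by
          rw [← Real.exp_nat_mul]
          congr 1
          push_cast
          field_simp
  refine ⟨by rw [hform]; positivity, ?_⟩
  calc ((n + 2 : ℕ) : ℝ) * lambdaC (n + 2)
      = (1 + 2 * (n : ℝ)⁻¹) * (1 + (n : ℝ)⁻¹) ^ (n + 1) := by
        rw [hform]
        push_cast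
        field_simp
    _ ≤ (1 + 2 * (n : ℝ)⁻¹) * Real.exp (1 + (n : ℝ)⁻¹) := by gcongr
    _ ≤ Real.exp 1 * (1 + ε) := (hN n (by omega)).le

section FixedPoint

variable {V : Type} [Fintype V] {G : SimpleGraph V} [DecidableRel G.Adj]
  {lam : ℝ} {ω : V → ℝ}

lemma fixedPoint_eq_exp_neg_sum_log (hlam : 0 ≤ lam) (h0 : ∀ u, 0 ≤ ω u)
    (hfix : bpF G lam ω = ω) (v : V) :
    ω v = Real.exp (-∑ u ∈ G.neighborFinset v, Real.log (1 + lam * ω u)) := by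
  have h : ω v = ∏ u ∈ G.neighborFinset v, (1 + lam * ω u)⁻¹ := (congrFun hfix v).symm
  rw [h, Real.exp_neg, Real.exp_sum, ← Finset.prod_inv_distrib]
  refine Finset.prod_congr rfl fun u _ => ?_
  have := mul_nonneg hlam (h0 u)
  rw [Real.exp_log (by linarith)]

lemma exp_neg_maxDegree_mul_le_fixedPoint (hlam : 0 ≤ lam)
    (hω : ∀ u, ω u ∈ Set.Icc (0 : ℝ) 1) (hfix : bpF G lam ω = ω) (v : V) :
    Real.exp (-(G.maxDegree * lam)) ≤ ω v := by
  rw [fixedPoint_eq_exp_neg_sum_log hlam (fun u => (hω u).1) hfix v, Real.exp_le_exp, neg_le_neg_iff]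
  calc ∑ u ∈ G.neighborFinset v, Real.log (1 + lam * ω u)
      ≤ ∑ _u ∈ G.neighborFinset v, lam := by
        refine Finset.sum_le_sum fun u _ => ?_
        have h1 := mul_nonneg hlam (hω u).1
        have h2 := mul_le_of_le_one_right hlam (hω u).2
        linarith [Real.log_le_sub_one_of_pos (show 0 < 1 + lam * ω u by linarith)]
    _ = G.degree v * lam := by simp
    _ ≤ G.maxDegree * lam := by
        gcongr
        exact G.degree_le_maxDegree v

/-- The Jacobian of belief propagation at a fixed point `ω`, weighted by `ω ^ (-1/2)`. -/
lemma sq_sum_inv_sqrt_fixedPoint_le (hlam : 0 ≤ lam) (hpos : ∀ u, 0 < ω u)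
    (hfix : bpF G lam ω = ω) (v : V) :
    (∑ u ∈ G.neighborFinset v, lam * ω u / (1 + lam * ω u) * (√(ω u))⁻¹) ^ 2
      ≤ G.maxDegree * lam * (Real.exp 1)⁻¹ * (ω v)⁻¹ := by
  set t := ∑ u ∈ G.neighborFinset v, Real.log (1 + lam * ω u) with ht
  have hterm : ∀ u, (lam * ω u / (1 + lam * ω u) * (√(ω u))⁻¹) ^ 2
      ≤ lam * Real.log (1 + lam * ω u) := by
    intro u
    have hx : 0 ≤ lam * ω u := mul_nonneg hlam (hpos u).le
    have hx1 : 0 < 1 + lam * ω u := by linarith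
    have hlog := Real.one_sub_inv_le_log_of_pos hx1
    have hsq : (lam * ω u / (1 + lam * ω u) * (√(ω u))⁻¹) ^ 2
        = lam * ((1 - (1 + lam * ω u)⁻¹) * (1 + lam * ω u)⁻¹) := by
      have := (hpos u).ne'
      rw [mul_pow, inv_pow, Real.sq_sqrt (hpos u).le]
      field_simp
      ring
    have hinv : (1 + lam * ω u)⁻¹ ≤ 1 := inv_le_one_of_one_le₀ (by linarith)
    rw [hsq]
    refine mul_le_mul_of_nonneg_left ?_ hlam
    exact (mul_le_of_le_one_right (by linarith) hinv).trans hlog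
  have hω : (ω v)⁻¹ = Real.exp t := by
    rw [fixedPoint_eq_exp_neg_sum_log hlam (fun u => (hpos u).le) hfix v, Real.exp_neg, inv_inv]
  calc _ ≤ ((G.neighborFinset v).card : ℝ) * ∑ u ∈ G.neighborFinset v,
        (lam * ω u / (1 + lam * ω u) * (√(ω u))⁻¹) ^ 2 := sq_sum_le_card_mul_sum_sq
    _ ≤ (G.maxDegree : ℝ) * (lam * t) := by
        rw [ht, Finset.mul_sum _ _ lam]
        refine mul_le_mul ?_ (Finset.sum_le_sum fun u _ => hterm u)
          (Finset.sum_nonneg fun u _ => sq_nonneg _) (Nat.cast_nonneg _)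
        rw [G.card_neighborFinset_eq_degree]
        exact_mod_cast G.degree_le_maxDegree v
    _ ≤ (G.maxDegree : ℝ) * (lam * Real.exp (t - 1)) := by
        gcongr
        linarith [Real.add_one_le_exp (t - 1)]
    _ = G.maxDegree * lam * (Real.exp 1)⁻¹ * (ω v)⁻¹ := by
        rw [hω, Real.exp_sub]
        ring

end FixedPoint

end HardCore

theorem path_coupling_distance_function_exists :
    ∀ δ : ℝ, 0 < δ →
    ∃ Δ₀ : ℕ,
      ∀ (V : Type) [Fintype V] [DecidableEq V] (G : SimpleGraph V) [DecidableRel G.Adj]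
        (Δ : ℕ) (lam : ℝ),
        G.maxDegree = Δ → Δ₀ ≤ Δ →
        0 < lam → lam < (1 - δ) * lambdaC Δ →
        ∀ ωstar : V → ℝ, (∀ u : V, ωstar u ∈ Set.Icc (0 : ℝ) 1) →
          bpF G lam ωstar = ωstar →
        ∃ Φ : V → ℝ, ∀ v : V,
          (1 ≤ Φ v ∧ Φ v ≤ 12) ∧
          (∑ u ∈ G.neighborFinset v, (lam * ωstar u / (1 + lam * ωstar u)) * Φ u
              ≤ (1 - δ / 6) * Φ v) := by
  intro δ hδ
  obtain ⟨D₀, hD₀⟩ := exists_forall_mul_lambdaC_le (half_pos hδ)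
  refine ⟨D₀, ?_⟩
  intro V _ _ G _ Δ lam hΔ hD hlam hlt ω hω hfix
  obtain ⟨hc0, hc⟩ := hD₀ Δ hD
  have hδ1 : δ < 1 := by
    by_contra! h
    nlinarith
  have he := Real.exp_pos 1
  have hdl : (G.maxDegree : ℝ) * lam ≤ Real.exp 1 * (1 - δ / 6) ^ 2 := by
    rw [hΔ]
    calc (Δ : ℝ) * lam ≤ Δ * ((1 - δ) * lambdaC Δ) := by gcongr
      _ = (1 - δ) * (Δ * lambdaC Δ) := by ring
      _ ≤ (1 - δ) * (Real.exp 1 * (1 + δ / 2)) :=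
          mul_le_mul_of_nonneg_left hc (by linarith)
      _ = Real.exp 1 * ((1 - δ) * (1 + δ / 2)) := by ring
      _ ≤ Real.exp 1 * (1 - δ / 6) ^ 2 := by
          gcongr
          nlinarith
  have hlow := exp_neg_maxDegree_mul_le_fixedPoint hlam.le hω hfix
  have hpos : ∀ u, 0 < ω u := fun u => (Real.exp_pos _).trans_le (hlow u)
  refine ⟨fun v => (√(ω v))⁻¹, fun v => ⟨⟨?_, ?_⟩, ?_⟩⟩
  · exact (one_le_inv₀ (Real.sqrt_pos.2 (hpos v))).2 (Real.sqrt_le_one.2 (hω v).2)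
  · have h3 : (G.maxDegree : ℝ) * lam ≤ 3 := by
      have h1 : (1 - δ / 6) ^ 2 ≤ 1 := by nlinarith
      nlinarith [Real.exp_one_lt_d9]
    have h27 : Real.exp 3 ≤ 144 := by
      rw [show (3 : ℝ) = (3 : ℕ) * 1 by norm_num, Real.exp_nat_mul]
      calc Real.exp 1 ^ 3 ≤ 3 ^ 3 := by
            gcongr
            linarith [Real.exp_one_lt_d9]
        _ ≤ 144 := by norm_num
    change (√(ω v))⁻¹ ≤ 12
    rw [← Real.sqrt_inv, Real.sqrt_le_left (by norm_num)]
    calc (ω v)⁻¹ ≤ (Real.exp (-(G.maxDegree * lam)))⁻¹ := inv_anti₀ (Real.exp_pos _) (hlow v)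
      _ = Real.exp (G.maxDegree * lam) := by rw [Real.exp_neg, inv_inv]
      _ ≤ Real.exp 3 := Real.exp_le_exp.2 h3
      _ ≤ 12 ^ 2 := by linarith
  · refine (le_abs_self _).trans (abs_le_of_sq_le_sq ?_ (mul_nonneg (by linarith) (by positivity)))
    calc _ ≤ G.maxDegree * lam * (Real.exp 1)⁻¹ * (ω v)⁻¹ :=
          sq_sum_inv_sqrt_fixedPoint_le hlam.le hpos hfix v
      _ ≤ Real.exp 1 * (1 - δ / 6) ^ 2 * (Real.exp 1)⁻¹ * (ω v)⁻¹ := by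
          have := (hpos v).le
          gcongr
      _ = ((1 - δ / 6) * (√(ω v))⁻¹) ^ 2 := by
          rw [mul_pow, inv_pow, Real.sq_sqrt (hpos v).le]
          field_simp
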